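/- Let H be a complex Hilbert space, A : H → H a bounded selfadjoint operator with ⟨Au,u⟩ ≥ c‖u‖² (c > 0), let l₁,…,lₙ be positive integers and 0 ≤ φ < π. There exists C > 0 such that for every λ ∈ S_φ, every ξ ∈ ℝⁿ, every t ∈ (0,∞)ⁿ, every k and every integer 0 ≤ i ≤ 2lₖ, the operator A + (λ + Σⱼ tⱼ ξⱼ^{2lⱼ})·I is invertible in L(H) and both: tₖ^{i/(2lₖ)} |λ|^{1−i/(2lₖ)} |ξₖ|^{i} ‖(A + (λ + Σⱼ tⱼ ξⱼ^{2lⱼ})·I)^{−1}‖_{L(H)} ≤ C and ‖A ∘ (A + (λ + Σⱼ tⱼ ξⱼ^{2lⱼ})·I)^{−1}‖_{L(H)} ≤ C. -/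

import Mathlib

/-- The sector `S_φ = {λ ∈ ℂ : |arg λ| ≤ φ} ∪ {0}`. -/
def Sector (φ : ℝ) : Set ℂ := {z | z = 0 ∨ |z.arg| ≤ φ}

/-- If `q` makes an angle at most `φ` with the positive half-axis, then `‖q + r‖` is comparable
to `‖q‖ + r` for `r ≥ 0`. -/
lemma cos_half_mul_norm_add_le_norm_add {φ : ℝ} (hφ0 : 0 ≤ φ) (hφπ : φ ≤ Real.pi) {q : ℂ}
    (hq : Real.cos φ * ‖q‖ ≤ q.re) {r : ℝ} (hr : 0 ≤ r) :
    Real.cos (φ / 2) * (‖q‖ + r) ≤ ‖q + (r : ℂ)‖ := by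
  have hδ : 0 ≤ Real.cos (φ / 2) := Real.cos_nonneg_of_mem_Icc ⟨by linarith, by linarith⟩
  have hcos : Real.cos φ = 2 * Real.cos (φ / 2) ^ 2 - 1 := by
    rw [← Real.cos_two_mul]
    ring_nf
  have hsq : ‖q + (r : ℂ)‖ ^ 2 = ‖q‖ ^ 2 + 2 * r * q.re + r ^ 2 := by
    rw [Complex.sq_norm, Complex.sq_norm, Complex.normSq_apply, Complex.normSq_apply]
    simp
    ring
  refine le_of_sq_le_sq ?_ (norm_nonneg _)
  rw [hsq]
  rw [hcos] at hq
  have hδ1 : 0 ≤ 1 - Real.cos (φ / 2) ^ 2 := by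
    nlinarith [Real.sin_sq_add_cos_sq (φ / 2), sq_nonneg (Real.sin (φ / 2))]
  nlinarith [mul_nonneg hδ1 (sq_nonneg (‖q‖ - r)), mul_le_mul_of_nonneg_left hq hr]

lemma cos_mul_norm_le_re_of_mem_sector {φ : ℝ} (hφπ : φ ≤ Real.pi) {z : ℂ} (hz : z ∈ Sector φ) :
    Real.cos φ * ‖z‖ ≤ z.re := by
  rcases hz with rfl | hz
  · simp
  · rw [← Complex.norm_mul_cos_arg z, mul_comm, ← Real.cos_abs z.arg]
    exact mul_le_mul_of_nonneg_left
      (Real.cos_le_cos_of_nonneg_of_le_pi (abs_nonneg _) hφπ hz) (norm_nonneg _)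

section Resolvent

variable {H : Type*} [NormedAddCommGroup H] [InnerProductSpace ℂ H]

/-- Lower bound for the numerical range of a shifted positive operator. -/
lemma le_norm_inner_add_smul_one {A : H →L[ℂ] H} (hA : A.IsSymmetric) {c : ℝ}
    (hc : 0 ≤ c) (hcoer : ∀ u : H, c * ‖u‖ ^ 2 ≤ (inner ℂ (A u) u : ℂ).re)
    {φ : ℝ} (hφ0 : 0 ≤ φ) (hφπ : φ ≤ Real.pi) {z : ℂ} (hz : z ∈ Sector φ) {s : ℝ} (hs : 0 ≤ s)
    (u : H) :
    ‖u‖ ^ 2 * (Real.cos (φ / 2) * (‖z‖ + s + c)) ≤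
      ‖inner ℂ ((A + (z + (s : ℂ)) • (1 : H →L[ℂ] H)) u) u‖ := by
  set a := (inner ℂ (A u) u : ℂ).re
  have hδ : 0 ≤ Real.cos (φ / 2) := Real.cos_nonneg_of_mem_Icc ⟨by linarith, by linarith⟩
  have hcu : 0 ≤ c * ‖u‖ ^ 2 := by positivity
  have hA_inner : (inner ℂ (A u) u : ℂ) = (a : ℂ) :=
    (Complex.conj_eq_iff_re.mp (hA.conj_inner_sym u u)).symm
  have hinner : inner ℂ ((A + (z + (s : ℂ)) • (1 : H →L[ℂ] H)) u) u =
      (starRingEnd ℂ) (z * (‖u‖ ^ 2 : ℝ) + ((s * ‖u‖ ^ 2 + a : ℝ) : ℂ)) := by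
    simp only [add_apply, smul_apply, one_apply_eq_self,
      inner_add_left, inner_smul_left, hA_inner, inner_self_eq_norm_sq_to_K]
    simp
    ring
  have hq : Real.cos φ * ‖z * (‖u‖ ^ 2 : ℝ)‖ ≤ (z * (‖u‖ ^ 2 : ℝ)).re := by
    rw [Complex.re_mul_ofReal, norm_mul, Complex.norm_of_nonneg (by positivity), ← mul_assoc]
    exact mul_le_mul_of_nonneg_right (cos_mul_norm_le_re_of_mem_sector hφπ hz) (by positivity)
  have hr : 0 ≤ s * ‖u‖ ^ 2 + a := add_nonneg (by positivity) (hcu.trans (hcoer u))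
  have key := cos_half_mul_norm_add_le_norm_add hφ0 hφπ hq hr
  rw [norm_mul, Complex.norm_of_nonneg (by positivity)] at key
  rw [hinner, RCLike.norm_conj]
  refine le_trans ?_ key
  nlinarith [mul_le_mul_of_nonneg_left (hcoer u) hδ]

/-- An operator with numerical range bounded away from zero by `m` is invertible, with inverse of
norm at most `m⁻¹`. -/
lemma isUnit_and_norm_inverse_le_of_le_norm_inner [CompleteSpace H] {T : H →L[ℂ] H} {m : ℝ}
    (hm : 0 < m) (hT : ∀ u, ‖u‖ ^ 2 * m ≤ ‖inner ℂ (T u) u‖) :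
    IsUnit T ∧ ‖Ring.inverse T‖ ≤ m⁻¹ := by
  have hunit : IsUnit T :=
    T.isUnit_of_forall_le_norm_inner_map (c := ⟨m, hm.le⟩) hm hT
  refine ⟨hunit, ContinuousLinearMap.opNorm_le_bound _ (by positivity) fun v => ?_⟩
  set u := Ring.inverse T v with hu
  have hTu : T u = v := by
    rw [hu, ← mul_apply_eq_comp, Ring.mul_inverse_cancel T hunit,
      one_apply_eq_self]
  have h := (hT u).trans (norm_inner_le_norm _ _)
  rw [hTu] at h
  rcases (norm_nonneg u).eq_or_lt with h0 | h0
  · rw [← h0]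
    positivity
  · rw [inv_mul_eq_div, le_div_iff₀ hm]
    nlinarith

end Resolvent

/-- Weighted AM-GM inequality in the form used for mixed multiplier symbols. -/
lemma rpow_mul_rpow_mul_abs_pow_le_add {t b x : ℝ} (ht : 0 ≤ t) (hb : 0 ≤ b) {l i : ℕ}
    (hl : 0 < l) (hi : i ≤ 2 * l) :
    t ^ ((i : ℝ) / (2 * l)) * b ^ (1 - (i : ℝ) / (2 * l)) * |x| ^ i ≤ b + t * x ^ (2 * l) := by
  have hl' : (0 : ℝ) < 2 * l := by positivity
  have hθ0 : 0 ≤ (i : ℝ) / (2 * l) := by positivity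
  have hθ1 : (i : ℝ) / (2 * l) ≤ 1 := by
    rw [div_le_one hl']
    exact_mod_cast hi
  have hx : x ^ (2 * l) = |x| ^ (2 * l) := ((even_two_mul l).pow_abs x).symm
  have hpow : (|x| ^ (2 * l)) ^ ((i : ℝ) / (2 * l)) = |x| ^ i := by
    rw [← Real.rpow_natCast, ← Real.rpow_mul (abs_nonneg x), ← Real.rpow_natCast]
    congr 1
    push_cast
    field_simp
  have ha : 0 ≤ t * |x| ^ (2 * l) := by positivity
  have h := Real.geom_mean_le_arith_mean2_weighted hθ0 (sub_nonneg.mpr hθ1) ha hb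
    (add_sub_cancel _ _)
  rw [Real.mul_rpow ht (by positivity), hpow] at h
  rw [hx]
  nlinarith [mul_nonneg hθ0 hb, mul_nonneg (sub_nonneg.mpr hθ1) ha]


/-- Uniform bounds on the multiplier functions `φ_{λ,t}` and `φ_{k,i}` from the proof of
Theorem 5.1: for `λ ∈ S_φ`, `ξ ∈ ℝⁿ`, `t ∈ (0,∞)ⁿ`, `k` and `0 ≤ i ≤ 2 l k`, the operator
`A + (λ + ∑ j, t j ξ j ^ (2 l j)) • I` is invertible, and both
`t k ^ (i/(2 l k)) |λ| ^ (1 - i/(2 l k)) |ξ k| ^ i ‖(A + (λ + ∑ j, t j ξ j ^ (2 l j)) • I)⁻¹‖ ≤ C`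
and `‖A ∘ (A + (λ + ∑ j, t j ξ j ^ (2 l j)) • I)⁻¹‖ ≤ C`. -/
theorem uniform_multiplier_bounds {H : Type*} [NormedAddCommGroup H] [InnerProductSpace ℂ H]
    [CompleteSpace H] (A : H →L[ℂ] H) (hA : IsSelfAdjoint A) (c : ℝ) (hc : 0 < c)
    (hcoer : ∀ u : H, c * ‖u‖ ^ 2 ≤ (inner ℂ (A u) u : ℂ).re)
    (n : ℕ) (l : Fin n → ℕ) (hl : ∀ k, 0 < l k)
    (φ : ℝ) (hφ0 : 0 ≤ φ) (hφπ : φ < Real.pi) :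
    ∃ C : ℝ, 0 < C ∧ ∀ z : ℂ, z ∈ Sector φ → ∀ ξ : Fin n → ℝ,
      ∀ t : Fin n → ℝ, (∀ j, 0 < t j) → ∀ k : Fin n, ∀ i : ℕ, i ≤ 2 * l k →
      IsUnit (A + (z + ((∑ j, t j * ξ j ^ (2 * l j) : ℝ) : ℂ)) • (1 : H →L[ℂ] H)) ∧
      t k ^ ((i : ℝ) / (2 * l k)) * ‖z‖ ^ (1 - (i : ℝ) / (2 * l k)) * |ξ k| ^ i *
        ‖Ring.inverse (A + (z + ((∑ j, t j * ξ j ^ (2 * l j) : ℝ) : ℂ)) • (1 : H →L[ℂ] H))‖ ≤ C ∧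
      ‖A ∘L Ring.inverse (A + (z + ((∑ j, t j * ξ j ^ (2 * l j) : ℝ) : ℂ)) • (1 : H →L[ℂ] H))‖
        ≤ C := by
  have hδ : 0 < Real.cos (φ / 2) := Real.cos_pos_of_mem_Ioo ⟨by linarith, by linarith⟩
  set δ := Real.cos (φ / 2)
  refine ⟨δ⁻¹ + ‖A‖ * (δ * c)⁻¹, by positivity, fun z hz ξ t ht k i hi => ?_⟩
  set s := ∑ j, t j * ξ j ^ (2 * l j)
  have hterm : ∀ j, 0 ≤ t j * ξ j ^ (2 * l j) := fun j =>
    mul_nonneg (ht j).le ((even_two_mul (l j)).pow_nonneg (ξ j))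
  have hs : 0 ≤ s := Finset.sum_nonneg fun j _ => hterm j
  have hm : 0 < δ * (‖z‖ + s + c) := by positivity
  obtain ⟨hunit, hinv⟩ := isUnit_and_norm_inverse_le_of_le_norm_inner hm
    (le_norm_inner_add_smul_one hA.isSymmetric hc.le hcoer hφ0 hφπ.le hz hs)
  have hsymbol : t k ^ ((i : ℝ) / (2 * l k)) * ‖z‖ ^ (1 - (i : ℝ) / (2 * l k)) * |ξ k| ^ i ≤
      ‖z‖ + s + c := by
    have hk : t k * ξ k ^ (2 * l k) ≤ s :=
      Finset.single_le_sum (f := fun j => t j * ξ j ^ (2 * l j)) (fun j _ => hterm j)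
        (Finset.mem_univ k)
    linarith [rpow_mul_rpow_mul_abs_pow_le_add (x := ξ k) (ht k).le (norm_nonneg z) (hl k) hi]
  refine ⟨hunit, ?_, ?_⟩
  · calc _ ≤ (‖z‖ + s + c) * (δ * (‖z‖ + s + c))⁻¹ :=
          mul_le_mul hsymbol hinv (norm_nonneg _) (by positivity)
      _ = δ⁻¹ := by
          have : ‖z‖ + s + c ≠ 0 := by positivity
          field_simp
      _ ≤ _ := le_add_of_nonneg_right (by positivity)
  · calc _ ≤ ‖A‖ * (δ * (‖z‖ + s + c))⁻¹ :=
          (A.opNorm_comp_le _).trans (mul_le_mul_of_nonneg_left hinv (norm_nonneg _))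
      _ ≤ ‖A‖ * (δ * c)⁻¹ := by
          gcongr
          linarith [norm_nonneg z]
      _ ≤ _ := le_add_of_nonneg_left (by positivity)
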